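/- For every a ∈ Γ₊ := {a ∈ ∂D : q(a) ∈ ℝ₊², |q(a)| = 1} and every z = (x₁,x₂) ∈ ℕ*×ℕ*, the function h_a(z) defined by h_a(z) = x₁ e^{a·z} − 𝔼_z[S₁(τ) e^{a·S(τ)}; τ < ∞] if q(a) = (0,1), h_a(z) = x₂ e^{a·z} − 𝔼_z[S₂(τ) e^{a·S(τ)}; τ < ∞] if q(a) = (1,0), and h_a(z) = e^{a·z} − 𝔼_z[e^{a·S(τ)}; τ < ∞] otherwise, is strictly positive and harmonic for the random walk killed when leaving the positive quadrant. -/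

import Mathlib

open scoped ENNReal Classical

noncomputable section

namespace KilledRW

/-- The two-dimensional integer lattice. -/
abbrev Z2 := ℤ × ℤ

/-- The plane `ℝ²`. -/
abbrev R2 := ℝ × ℝ

/-- Euclidean dot product on `ℝ²`. -/
def dotR (a b : R2) : ℝ := a.1 * b.1 + a.2 * b.2

/-- Embedding of the lattice into the plane. -/
def emb (z : Z2) : R2 := ((z.1 : ℝ), (z.2 : ℝ))

/-- Euclidean norm on `ℝ²`. -/
def nrm (x : R2) : ℝ := Real.sqrt (dotR x x)

/-- The jump generating function `φ(a) = Σ_z γ(z) e^{a·z}`. -/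
def jgf (γ : Z2 → ℝ) (a : R2) : ℝ := ∑' z : Z2, γ z * Real.exp (dotR a (emb z))

/-- The gradient `∇φ(a) = Σ_z z γ(z) e^{a·z}` of the jump generating function. -/
def gradJgf (γ : Z2 → ℝ) (a : R2) : R2 :=
  (∑' z : Z2, γ z * Real.exp (dotR a (emb z)) * (z.1 : ℝ),
   ∑' z : Z2, γ z * Real.exp (dotR a (emb z)) * (z.2 : ℝ))

/-- The normalized gradient `q(a) = ∇φ(a)/|∇φ(a)|`. -/
def qmap (γ : Z2 → ℝ) (a : R2) : R2 := (nrm (gradJgf γ a))⁻¹ • gradJgf γ a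

/-- (Sub)stochastic transition kernel of the twisted random walk `S_a`:
`p_a(z,z') = γ(z'-z) e^{a·(z'-z)}`.  For `a = 0` this is the kernel of the original walk. -/
def twKer (γ : Z2 → ℝ) (a : R2) (z z' : Z2) : ℝ≥0∞ :=
  ENNReal.ofReal (γ (z' - z) * Real.exp (dotR a (emb (z' - z))))

/-- `n`-step transition probabilities of the (sub)stochastic kernel `κ`. -/
def nstep (κ : Z2 → Z2 → ℝ≥0∞) : ℕ → Z2 → Z2 → ℝ≥0∞
  | 0, z, z' => if z' = z then 1 else 0
  | n + 1, z, z' => ∑' w : Z2, κ z w * nstep κ n w z'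

/-- `exitP κ A n z z' = ℙ_z(τ_A = n, S(n) = z')`: the probability that the walk with kernel `κ`
started at `z` stays in `A` strictly before time `n` and is at `z' ∉ A` at time `n`
(where `τ_A = inf{n ≥ 0 : S(n) ∉ A}`). -/
def exitP (κ : Z2 → Z2 → ℝ≥0∞) (A : Set Z2) : ℕ → Z2 → Z2 → ℝ≥0∞
  | 0, z, z' => if z' = z ∧ z ∉ A then 1 else 0
  | n + 1, z, z' => if z ∈ A then ∑' w : Z2, κ z w * exitP κ A n w z' else 0

/-- `aliveP κ A n z z' = ℙ_z(τ_A > n, S(n) = z')`. -/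
def aliveP (κ : Z2 → Z2 → ℝ≥0∞) (A : Set Z2) : ℕ → Z2 → Z2 → ℝ≥0∞
  | 0, z, z' => if z' = z ∧ z ∈ A then 1 else 0
  | n + 1, z, z' => if z ∈ A then ∑' w : Z2, κ z w * aliveP κ A n w z' else 0

/-- `ℙ_z(τ_A < ∞)` for the walk with kernel `κ`. -/
def exitTotal (κ : Z2 → Z2 → ℝ≥0∞) (A : Set Z2) (z : Z2) : ℝ≥0∞ :=
  ∑' n : ℕ, ∑' z' : Z2, exitP κ A n z z'

/-- `𝔼_z[g(S(τ_A)); τ_A < ∞]` for a nonnegative integrand, with values in `ℝ≥0∞`. -/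
def exitLExp (κ : Z2 → Z2 → ℝ≥0∞) (A : Set Z2) (z : Z2) (g : Z2 → ℝ) : ℝ≥0∞ :=
  ∑' n : ℕ, ∑' z' : Z2, exitP κ A n z z' * ENNReal.ofReal (g z')

/-- `𝔼_z[g(S(τ_A)); τ_A < ∞]` for a signed integrand (positive part minus negative part). -/
def exitExp (κ : Z2 → Z2 → ℝ≥0∞) (A : Set Z2) (z : Z2) (g : Z2 → ℝ) : ℝ :=
  (exitLExp κ A z g).toReal - (exitLExp κ A z fun w => -g w).toReal

/-- `𝔼_z[g(S(τ_A)); τ_A ≤ n]`, nonnegative version. -/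
def exitLExpTrunc (κ : Z2 → Z2 → ℝ≥0∞) (A : Set Z2) (z : Z2) (g : Z2 → ℝ) (n : ℕ) : ℝ≥0∞ :=
  ∑ m ∈ Finset.range (n + 1), ∑' z' : Z2, exitP κ A m z z' * ENNReal.ofReal (g z')

/-- `𝔼_z[g(S(τ_A)); τ_A ≤ n]`, signed version. -/
def exitExpTrunc (κ : Z2 → Z2 → ℝ≥0∞) (A : Set Z2) (z : Z2) (g : Z2 → ℝ) (n : ℕ) : ℝ :=
  (exitLExpTrunc κ A z g n).toReal - (exitLExpTrunc κ A z (fun w => -g w) n).toReal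

/-- `𝔼_z[g(S(n)); τ_A > n]`, nonnegative version. -/
def aliveLExpAt (κ : Z2 → Z2 → ℝ≥0∞) (A : Set Z2) (z : Z2) (g : Z2 → ℝ) (n : ℕ) : ℝ≥0∞ :=
  ∑' z' : Z2, aliveP κ A n z z' * ENNReal.ofReal (g z')

/-- `𝔼_z[g(S(n)); τ_A > n]`, signed version. -/
def aliveExpAt (κ : Z2 → Z2 → ℝ≥0∞) (A : Set Z2) (z : Z2) (g : Z2 → ℝ) (n : ℕ) : ℝ :=
  (aliveLExpAt κ A z g n).toReal - (aliveLExpAt κ A z (fun w => -g w) n).toReal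

section ExitFunctional

variable {κ : Z2 → Z2 → ℝ≥0∞} {A : Set Z2}

lemma exitLExp_of_notMem {z : Z2} (hz : z ∉ A) (g : Z2 → ℝ) :
    exitLExp κ A z g = ENNReal.ofReal (g z) := by
  unfold exitLExp
  rw [tsum_eq_single 0, tsum_eq_single z]
  · simp [exitP, hz]
  · intro w hw
    simp [exitP, hw]
  · intro n hn
    obtain ⟨m, rfl⟩ := Nat.exists_eq_succ_of_ne_zero hn
    simp [exitP, hz]

/-- First-step decomposition of a single exit term. -/
lemma tsum_exitP_succ {z : Z2} (hz : z ∈ A) (g : Z2 → ℝ) (n : ℕ) :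
    ∑' z', exitP κ A (n + 1) z z' * ENNReal.ofReal (g z') =
      ∑' w, κ z w * ∑' z', exitP κ A n w z' * ENNReal.ofReal (g z') := by
  simp only [exitP, if_pos hz, ← ENNReal.tsum_mul_right, ← ENNReal.tsum_mul_left]
  rw [ENNReal.tsum_comm]
  simp only [mul_assoc]

/-- First-step decomposition of the exit functional. -/
lemma exitLExp_of_mem {z : Z2} (hz : z ∈ A) (g : Z2 → ℝ) :
    exitLExp κ A z g = ∑' w, κ z w * exitLExp κ A w g := by
  have h0 : ∑' z', exitP κ A 0 z z' * ENNReal.ofReal (g z') = 0 := by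
    simp [exitP, hz]
  unfold exitLExp
  rw [tsum_eq_zero_add' ENNReal.summable, h0, zero_add]
  simp only [tsum_exitP_succ hz, ← ENNReal.tsum_mul_left]
  rw [ENNReal.tsum_comm]

/-- The exit functional is the least nonnegative superharmonic function dominating the boundary
data. -/
lemma exitLExp_le_of_superharmonic {g : Z2 → ℝ} {G : Z2 → ℝ≥0∞}
    (hbd : ∀ w, w ∉ A → ENNReal.ofReal (g w) ≤ G w)
    (hsup : ∀ z, z ∈ A → ∑' w, κ z w * G w ≤ G z) (z : Z2) :
    exitLExp κ A z g ≤ G z := by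
  have key : ∀ N : ℕ, ∀ z, ∑ n ∈ Finset.range N,
      ∑' z', exitP κ A n z z' * ENNReal.ofReal (g z') ≤ G z := by
    intro N
    induction N with
    | zero => simp
    | succ N ih =>
      intro z
      by_cases hz : z ∈ A
      · have h0 : ∑' z', exitP κ A 0 z z' * ENNReal.ofReal (g z') = 0 := by
          simp [exitP, hz]
        rw [Finset.sum_range_succ', h0, add_zero]
        simp only [tsum_exitP_succ hz]
        rw [← Summable.tsum_finsetSum (fun _ _ => ENNReal.summable)]
        refine le_trans (ENNReal.tsum_le_tsum fun w => ?_) (hsup z hz)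
        rw [← Finset.mul_sum]
        gcongr
        exact ih w
      · refine le_trans (ENNReal.sum_le_tsum _) ?_
        have := exitLExp_of_notMem (κ := κ) hz g
        unfold exitLExp at this
        rw [this]
        exact hbd z hz
  unfold exitLExp
  rw [ENNReal.tsum_eq_iSup_nat]
  exact iSup_le fun N => key N z

lemma exitLExp_mono {g g' : Z2 → ℝ} (h : ∀ w, g w ≤ g' w) (z : Z2) :
    exitLExp κ A z g ≤ exitLExp κ A z g' := by
  unfold exitLExp
  gcongr
  exact h _

end ExitFunctional

section Walk

variable {γ : Z2 → ℝ} {K : Set Z2}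

lemma twKer_zero (γ : Z2 → ℝ) (z w : Z2) : twKer γ 0 z w = ENNReal.ofReal (γ (w - z)) := by
  simp [twKer, dotR]

/-- Comparison principle for real-valued superharmonic functions. -/
lemma exitLExp_le_ofReal (hγ0 : ∀ z, 0 ≤ γ z) {g G : Z2 → ℝ} (hG : ∀ w, 0 ≤ G w)
    (hbd : ∀ w, w ∉ K → g w ≤ G w)
    (hsup : ∀ z, z ∈ K → ∃ s ≤ G z, HasSum (fun w => γ (w - z) * G w) s) (z : Z2) :
    exitLExp (twKer γ 0) K z g ≤ ENNReal.ofReal (G z) := by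
  refine exitLExp_le_of_superharmonic (G := fun w => ENNReal.ofReal (G w))
    (fun w hw => ENNReal.ofReal_le_ofReal (hbd w hw)) (fun z hz => ?_) z
  obtain ⟨s, hs, hsum⟩ := hsup z hz
  simp only [twKer_zero, ← ENNReal.ofReal_mul (hγ0 _)]
  rw [← ENNReal.ofReal_tsum_of_nonneg (fun w => mul_nonneg (hγ0 _) (hG w)) hsum.summable,
    hsum.tsum_eq]
  exact ENNReal.ofReal_le_ofReal hs

lemma hasSum_exitLExp_toReal (hγ0 : ∀ z, 0 ≤ γ z) {g : Z2 → ℝ} {z : Z2} (hz : z ∈ K)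
    (hfin : exitLExp (twKer γ 0) K z g ≠ ⊤) :
    HasSum (fun w => γ (w - z) * (exitLExp (twKer γ 0) K w g).toReal)
      (exitLExp (twKer γ 0) K z g).toReal := by
  have h := exitLExp_of_mem (κ := twKer γ 0) hz g
  have hfin' : ∑' w, twKer γ 0 z w * exitLExp (twKer γ 0) K w g ≠ ⊤ := h ▸ hfin
  have h2 := ENNReal.hasSum_toReal hfin'
  rw [← ENNReal.tsum_toReal_eq (ENNReal.ne_top_of_tsum_ne_top hfin'), ← h] at h2
  simpa [twKer_zero, ENNReal.toReal_mul, ENNReal.toReal_ofReal (hγ0 _)] using h2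

/-- A nonnegative harmonic function is positive wherever a positive value can be reached. -/
lemma pos_of_aliveP_pos (hγ0 : ∀ z, 0 ≤ γ z) {h : Z2 → ℝ} (h0 : ∀ z, 0 ≤ h z)
    (hh : ∀ z, z ∈ K → HasSum (fun w => γ (w - z) * h w) (h z)) {z₀ : Z2} (hz₀ : 0 < h z₀)
    (n : ℕ) : ∀ z, 0 < aliveP (twKer γ 0) K n z z₀ → 0 < h z := by
  induction n with
  | zero =>
    intro z hz
    by_cases hc : z₀ = z ∧ z ∈ K
    · exact hc.1 ▸ hz₀
    · simp [aliveP, hc] at hz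
  | succ n ih =>
    intro z hz
    by_cases hc : z ∈ K
    · simp only [aliveP, if_pos hc] at hz
      obtain ⟨w, hw⟩ : ∃ w, twKer γ 0 z w * aliveP (twKer γ 0) K n w z₀ ≠ 0 := by
        by_contra! hcon
        simp [hcon] at hz
      rw [mul_ne_zero_iff] at hw
      have hw1 : 0 < γ (w - z) := by
        have := pos_iff_ne_zero.2 hw.1
        rwa [twKer_zero, ENNReal.ofReal_pos] at this
      have hw2 := ih w (pos_iff_ne_zero.2 hw.2)
      exact lt_of_lt_of_le (mul_pos hw1 hw2)
        (le_hasSum (hh z hc) w fun w' _ => mul_nonneg (hγ0 _) (h0 w'))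
    · simp [aliveP, hc] at hz

/-- Subtracting from a harmonic function, nonnegative on `K`, the expectation of its value at the
exit from `K` yields a harmonic function for the killed walk, positive as soon as it is positive
somewhere. -/
lemma sub_exitExp_pos_and_harmonic (hγ0 : ∀ z, 0 ≤ γ z)
    (hA2 : ∀ z z' : Z2, z ∈ K → z' ∈ K → ∃ n : ℕ, 0 < aliveP (twKer γ 0) K n z z')
    {f : Z2 → ℝ} (hf : ∀ z, HasSum (fun w => γ (w - z) * f w) (f z))
    (hf0 : ∀ z, z ∈ K → 0 ≤ f z)
    (hfin : ∀ z, exitLExp (twKer γ 0) K z (fun w => |f w|) ≠ ⊤)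
    {z₀ : Z2} (hz₀ : z₀ ∈ K) (hlt : exitLExp (twKer γ 0) K z₀ f < ENNReal.ofReal (f z₀))
    {h : Z2 → ℝ} (hh : ∀ z, h z = f z - exitExp (twKer γ 0) K z f) {z : Z2} (hz : z ∈ K) :
    0 < h z ∧ (∑' z' : Z2, if z' ∈ K then γ (z' - z) * h z' else 0) = h z := by
  have hfin1 : ∀ z, exitLExp (twKer γ 0) K z f ≠ ⊤ := fun z =>
    ne_top_of_le_ne_top (hfin z) (exitLExp_mono (fun w => le_abs_self _) z)
  have hfin2 : ∀ z, exitLExp (twKer γ 0) K z (fun w => -f w) ≠ ⊤ := fun z =>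
    ne_top_of_le_ne_top (hfin z) (exitLExp_mono (fun w => neg_le_abs _) z)
  have hoff : ∀ w, w ∉ K → h w = 0 := by
    intro w hw
    rw [hh, exitExp, exitLExp_of_notMem hw, exitLExp_of_notMem hw,
      ENNReal.toReal_ofReal', ENNReal.toReal_ofReal', max_zero_sub_max_neg_zero_eq_self, sub_self]
  have hharm : ∀ z, z ∈ K → HasSum (fun w => γ (w - z) * h w) (h z) := by
    intro z hz
    have h1 := hasSum_exitLExp_toReal hγ0 hz (hfin1 z)
    have h2 := hasSum_exitLExp_toReal hγ0 hz (hfin2 z)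
    have h3 := (hf z).sub (h1.sub h2)
    have h4 : (fun w => γ (w - z) * h w) = fun w => γ (w - z) * f w -
        (γ (w - z) * (exitLExp (twKer γ 0) K w f).toReal -
          γ (w - z) * (exitLExp (twKer γ 0) K w fun w => -f w).toReal) := by
      funext w
      rw [hh, exitExp]
      ring
    rw [h4, hh, exitExp]
    exact h3
  have hbase : ∀ w, f w + (exitLExp (twKer γ 0) K w (fun w => -f w)).toReal = max (f w) 0 ∨
      w ∈ K := by
    intro w
    by_cases hw : w ∈ K
    · exact Or.inr hw
    · left
      rw [exitLExp_of_notMem hw, ENNReal.toReal_ofReal']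
      rcases le_total 0 (f w) with h' | h' <;> simp [h']
  have hcomp : ∀ z, exitLExp (twKer γ 0) K z f ≤
      ENNReal.ofReal (f z + (exitLExp (twKer γ 0) K z (fun w => -f w)).toReal) := by
    refine exitLExp_le_ofReal hγ0 (fun w => ?_) (fun w hw => ?_) (fun z hz => ?_)
    · rcases hbase w with h' | h'
      · rw [h']
        exact le_max_right _ _
      · exact add_nonneg (hf0 w h') ENNReal.toReal_nonneg
    · rw [(hbase w).resolve_right hw]
      exact le_max_left _ _
    · refine ⟨_, le_rfl, ?_⟩
      have h3 := (hf z).add (hasSum_exitLExp_toReal hγ0 hz (hfin2 z))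
      simpa [mul_add] using h3
  have hnonneg : ∀ z, 0 ≤ h z := by
    intro z
    by_cases hz : z ∈ K
    · have h1 := ENNReal.toReal_mono ENNReal.ofReal_ne_top (hcomp z)
      rw [ENNReal.toReal_ofReal (add_nonneg (hf0 z hz) ENNReal.toReal_nonneg)] at h1
      rw [hh, exitExp]
      linarith
    · exact (hoff z hz).ge
  have hpos₀ : 0 < h z₀ := by
    have h1 := (ENNReal.toReal_lt_toReal (hfin1 z₀) ENNReal.ofReal_ne_top).2 hlt
    rw [ENNReal.toReal_ofReal (hf0 z₀ hz₀)] at h1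
    have h2 : 0 ≤ (exitLExp (twKer γ 0) K z₀ (fun w => -f w)).toReal := ENNReal.toReal_nonneg
    rw [hh, exitExp]
    linarith
  refine ⟨?_, ?_⟩
  · obtain ⟨n, hn⟩ := hA2 z z₀ hz hz₀
    exact pos_of_aliveP_pos hγ0 hnonneg hharm hpos₀ n z hn
  · rw [← (hharm z hz).tsum_eq]
    refine tsum_congr fun w => ?_
    by_cases hw : w ∈ K
    · simp [hw]
    · simp [hw, hoff w hw]

end Walk

section Exponentials

variable {γ : Z2 → ℝ}

lemma dotR_emb_add (b : R2) (z w : Z2) :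
    dotR b (emb (z + w)) = dotR b (emb z) + dotR b (emb w) := by
  simp only [dotR, emb, Prod.fst_add, Prod.snd_add, Int.cast_add]
  ring

lemma dotR_add_left (a b x : R2) : dotR (a + b) x = dotR a x + dotR b x := by
  simp only [dotR, Prod.fst_add, Prod.snd_add]
  ring

lemma dotR_sub_left (a b x : R2) : dotR (a - b) x = dotR a x - dotR b x := by
  simp only [dotR, Prod.fst_sub, Prod.snd_sub]
  ring

lemma dotR_smul_left (t : ℝ) (b x : R2) : dotR (t • b) x = t * dotR b x := by
  simp only [dotR, Prod.smul_fst, Prod.smul_snd, smul_eq_mul]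
  ring

lemma abs_le_exp_add_exp_neg (x : ℝ) : |x| ≤ Real.exp x + Real.exp (-x) := by
  have h1 := Real.add_one_le_exp x
  have h2 := Real.add_one_le_exp (-x)
  have h3 := Real.exp_pos x
  have h4 := Real.exp_pos (-x)
  exact abs_le.2 ⟨by linarith, by linarith⟩

lemma hasSum_jgf (hA3 : ∀ a : R2, Summable fun z : Z2 => γ z * Real.exp (dotR a (emb z)))
    (a : R2) : HasSum (fun y : Z2 => γ y * Real.exp (dotR a (emb y))) (jgf γ a) :=
  (hA3 a).hasSum

lemma hasSum_dotR_gradJgf (hγ0 : ∀ z, 0 ≤ γ z)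
    (hA3 : ∀ a : R2, Summable fun z : Z2 => γ z * Real.exp (dotR a (emb z))) (a b : R2) :
    HasSum (fun y : Z2 => γ y * Real.exp (dotR a (emb y)) * dotR b (emb y))
      (dotR b (gradJgf γ a)) := by
  have hs : ∀ c : R2, Summable fun y : Z2 =>
      γ y * Real.exp (dotR a (emb y)) * dotR c (emb y) := by
    intro c
    refine Summable.of_norm_bounded ((hA3 (a + c)).add (hA3 (a - c))) fun y => ?_
    rw [dotR_add_left, dotR_sub_left, Real.exp_add, sub_eq_add_neg, Real.exp_add, norm_mul,
      Real.norm_of_nonneg (mul_nonneg (hγ0 y) (Real.exp_pos _).le), Real.norm_eq_abs]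
    have h1 := mul_le_mul_of_nonneg_left (abs_le_exp_add_exp_neg (dotR c (emb y)))
      (mul_nonneg (hγ0 y) (Real.exp_pos (dotR a (emb y))).le)
    linarith
  have h1 := (hs (1, 0)).hasSum.mul_left b.1
  have h2 := (hs (0, 1)).hasSum.mul_left b.2
  have h3 := h1.add h2
  simp only [dotR, emb, one_mul, zero_mul, add_zero, zero_add] at h3
  simp only [dotR, gradJgf, emb]
  refine h3.congr_fun fun y => ?_
  ring

/-- The kernel acts on the exponential `e^{b·w}` as multiplication by `φ(b)`. -/
lemma hasSum_exp (hA3 : ∀ a : R2, Summable fun z : Z2 => γ z * Real.exp (dotR a (emb z)))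
    (b : R2) (z : Z2) :
    HasSum (fun w => γ (w - z) * Real.exp (dotR b (emb w)))
      (Real.exp (dotR b (emb z)) * jgf γ b) := by
  rw [← (Equiv.addRight z).hasSum_iff]
  refine ((hasSum_jgf hA3 b).mul_left (Real.exp (dotR b (emb z)))).congr_fun fun y => ?_
  simp only [Function.comp_apply, Equiv.coe_addRight, add_sub_cancel_right, dotR_emb_add,
    Real.exp_add]
  ring

lemma hasSum_dotR_mul_exp (hγ0 : ∀ z, 0 ≤ γ z)
    (hA3 : ∀ a : R2, Summable fun z : Z2 => γ z * Real.exp (dotR a (emb z)))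
    (a b : R2) (z : Z2) :
    HasSum (fun w => γ (w - z) * (dotR b (emb w) * Real.exp (dotR a (emb w))))
      (Real.exp (dotR a (emb z)) * (dotR b (emb z) * jgf γ a + dotR b (gradJgf γ a))) := by
  rw [← (Equiv.addRight z).hasSum_iff]
  refine ((((hasSum_jgf hA3 a).mul_left (dotR b (emb z))).add
    (hasSum_dotR_gradJgf hγ0 hA3 a b)).mul_left
      (Real.exp (dotR a (emb z)))).congr_fun fun y => ?_
  simp only [Function.comp_apply, Equiv.coe_addRight, add_sub_cancel_right, dotR_emb_add,
    Real.exp_add]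
  ring

lemma exp_sub_one_sub_le (x : ℝ) : Real.exp x - 1 - x ≤ x ^ 2 * Real.exp |x| := by
  have key : ∀ t : ℝ, Real.exp t - 1 ≤ t * Real.exp t := by
    intro t
    have h1 := Real.add_one_le_exp (-t)
    have h2 : Real.exp t * Real.exp (-t) = 1 := by rw [← Real.exp_add]; simp
    nlinarith [Real.exp_pos t]
  have h1 := key x
  rcases le_total 0 x with hx | hx
  · rw [abs_of_nonneg hx]
    nlinarith
  · have h2 := Real.add_one_le_exp x
    have h3 : 1 ≤ Real.exp |x| := Real.one_le_exp (abs_nonneg x)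
    nlinarith [sq_nonneg x]

lemma exp_neg_mul_le {θ : ℝ} (h0 : 0 ≤ θ) (h1 : θ ≤ 1) (y : ℝ) :
    Real.exp (-(θ * y)) ≤ 1 - θ * y + θ ^ 2 * (Real.exp (3 * y) + Real.exp (-(3 * y))) := by
  have h2 := exp_sub_one_sub_le (-(θ * y))
  have h3 : Real.exp |(-(θ * y))| ≤ Real.exp |y| := by
    rw [Real.exp_le_exp, abs_neg, abs_mul, abs_of_nonneg h0]
    exact mul_le_of_le_one_left (abs_nonneg y) h1
  have h4 : y ^ 2 ≤ Real.exp |y| ^ 2 := by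
    rw [← sq_abs]
    have := Real.add_one_le_exp |y|
    exact pow_le_pow_left₀ (abs_nonneg y) (by linarith) 2
  have h5 : Real.exp |y| ^ 2 * Real.exp |y| ≤ Real.exp (3 * y) + Real.exp (-(3 * y)) := by
    have : Real.exp |y| ^ 2 * Real.exp |y| = Real.exp (3 * |y|) := by
      rw [← Real.exp_nat_mul, ← Real.exp_add]
      congr 1
      push_cast
      ring
    rw [this]
    rcases abs_cases y with ⟨h, _⟩ | ⟨h, _⟩ <;> rw [h]
    · linarith [Real.exp_pos (-(3 * y))]
    · rw [mul_neg]
      linarith [Real.exp_pos (3 * y)]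
  have h6 : (-(θ * y)) ^ 2 * Real.exp |(-(θ * y))| ≤
      θ ^ 2 * (Real.exp (3 * y) + Real.exp (-(3 * y))) := by
    calc (-(θ * y)) ^ 2 * Real.exp |(-(θ * y))|
        ≤ (-(θ * y)) ^ 2 * Real.exp |y| := by gcongr
      _ = θ ^ 2 * (y ^ 2 * Real.exp |y|) := by ring
      _ ≤ θ ^ 2 * (Real.exp |y| ^ 2 * Real.exp |y|) := by gcongr
      _ ≤ _ := by gcongr
  linarith

lemma jgf_nonneg (hγ0 : ∀ z, 0 ≤ γ z) (a : R2) : 0 ≤ jgf γ a :=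
  tsum_nonneg fun y => mul_nonneg (hγ0 y) (Real.exp_pos _).le

/-- Moving from `a ∈ ∂D` against a direction of positive drift enters the interior of `D`. -/
lemma exists_jgf_sub_smul_lt_one (hγ0 : ∀ z, 0 ≤ γ z)
    (hA3 : ∀ a : R2, Summable fun z : Z2 => γ z * Real.exp (dotR a (emb z)))
    {a b : R2} (ha : jgf γ a = 1) (hb : 0 < dotR b (gradJgf γ a)) :
    ∃ θ : ℝ, 0 < θ ∧ jgf γ (a - θ • b) < 1 := by
  set m := dotR b (gradJgf γ a) with hm
  set C := jgf γ (a + (3 : ℝ) • b) + jgf γ (a - (3 : ℝ) • b) with hC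
  have hC0 : 0 ≤ C := add_nonneg (jgf_nonneg hγ0 _) (jgf_nonneg hγ0 _)
  have hθ : 0 < m / (C + 1 + m) := by positivity
  refine ⟨m / (C + 1 + m), hθ, ?_⟩
  set θ := m / (C + 1 + m) with hθd
  have hθ1 : θ ≤ 1 := by
    rw [hθd, div_le_one (by positivity)]
    linarith
  have hθC : θ * (C + 1 + m) = m := div_mul_cancel₀ _ (by positivity)
  have hle : jgf γ (a - θ • b) ≤ 1 - θ * m + θ ^ 2 * C := by
    have h1 := ((hasSum_jgf hA3 a).sub ((hasSum_dotR_gradJgf hγ0 hA3 a b).mul_left θ)).add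
      (((hasSum_jgf hA3 (a + (3 : ℝ) • b)).add
        (hasSum_jgf hA3 (a - (3 : ℝ) • b))).mul_left (θ ^ 2))
    rw [ha] at h1
    refine hasSum_le (fun y => ?_) (hasSum_jgf hA3 (a - θ • b)) h1
    simp only [dotR_sub_left, dotR_add_left, dotR_smul_left]
    simp only [sub_eq_add_neg (dotR a _), Real.exp_add]
    have h2 := mul_le_mul_of_nonneg_left (exp_neg_mul_le hθ.le hθ1 (dotR b (emb y)))
      (mul_nonneg (hγ0 y) (Real.exp_pos (dotR a (emb y))).le)
    linarith
  have : θ * C < m := by nlinarith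
  nlinarith

lemma one_sub_le_exp_neg (t : ℝ) : 0 ≤ Real.exp (-t) - 1 + t := by
  linarith [Real.add_one_le_exp (-t)]

lemma one_sub_lt_exp_neg {t : ℝ} (ht : t ≠ 0) : 0 < Real.exp (-t) - 1 + t := by
  linarith [Real.add_one_lt_exp (neg_ne_zero.2 ht)]

lemma hasSum_convexity_gap (hγ0 : ∀ z, 0 ≤ γ z)
    (hA3 : ∀ a : R2, Summable fun z : Z2 => γ z * Real.exp (dotR a (emb z)))
    (a b : R2) (hb : dotR b (gradJgf γ a) = 0) :
    HasSum (fun y => γ y * Real.exp (dotR a (emb y)) *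
      (Real.exp (-dotR b (emb y)) - 1 + dotR b (emb y))) (jgf γ (a - b) - jgf γ a) := by
  have h := ((hasSum_jgf hA3 (a - b)).sub (hasSum_jgf hA3 a)).add
    (hasSum_dotR_gradJgf hγ0 hA3 a b)
  rw [hb, add_zero] at h
  refine h.congr_fun fun y => ?_
  rw [dotR_sub_left, sub_eq_add_neg (dotR a _), Real.exp_add]
  ring

/-- Along a nondegenerate direction in which `φ` is critical, `φ` increases strictly. -/
lemma jgf_lt_jgf_sub (hγ0 : ∀ z, 0 ≤ γ z)
    (hA3 : ∀ a : R2, Summable fun z : Z2 => γ z * Real.exp (dotR a (emb z)))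
    {a b : R2} (hb : dotR b (gradJgf γ a) = 0) {y : Z2} (hy : 0 < γ y)
    (hby : dotR b (emb y) ≠ 0) : jgf γ a < jgf γ (a - b) := by
  have h := hasSum_convexity_gap hγ0 hA3 a b hb
  have h1 := le_hasSum h y fun w _ =>
    mul_nonneg (mul_nonneg (hγ0 w) (Real.exp_pos _).le) (one_sub_le_exp_neg _)
  have h2 := mul_pos (mul_pos hy (Real.exp_pos (dotR a (emb y)))) (one_sub_lt_exp_neg hby)
  linarith

/-- The gradient of `φ` does not vanish on `∂D` when the mean step is nonzero. -/
lemma gradJgf_ne_zero (hγ0 : ∀ z, 0 ≤ γ z) (hγ1 : HasSum γ 1)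
    (hA3 : ∀ a : R2, Summable fun z : Z2 => γ z * Real.exp (dotR a (emb z)))
    (hmean : (∑' z : Z2, γ z * (z.1 : ℝ), ∑' z : Z2, γ z * (z.2 : ℝ)) ≠ (0, 0))
    {a : R2} (ha : jgf γ a = 1) : gradJgf γ a ≠ (0, 0) := by
  intro hg
  have h := hasSum_convexity_gap hγ0 hA3 a a (by simp [hg, dotR])
  have h0 : jgf γ (a - a) = 1 := by
    rw [sub_self, jgf]
    simpa [dotR] using hγ1.tsum_eq
  rw [h0, ha, sub_self, hasSum_zero_iff_of_nonneg fun w =>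
    mul_nonneg (mul_nonneg (hγ0 w) (Real.exp_pos _).le) (one_sub_le_exp_neg _)] at h
  have h1 : ∀ y, γ y * Real.exp (dotR a (emb y)) = γ y := by
    intro y
    have hy := congrFun h y
    rcases mul_eq_zero.1 hy with h2 | h2
    · rcases mul_eq_zero.1 h2 with h3 | h3
      · simp [h3]
      · exact absurd h3 (Real.exp_pos _).ne'
    · have : dotR a (emb y) = 0 := by
        by_contra hne
        exact (one_sub_lt_exp_neg hne).ne' h2
      simp [this]
  apply hmean
  simpa only [gradJgf, h1] using hg

/-- A walk that changes the value of `b·z` has a step `y` with `b·y ≠ 0`. -/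
lemma exists_step_dotR_ne_zero {b : R2} {z' : Z2}
    (hz' : dotR b (emb z') ≠ 0) {n : ℕ} (hn : 0 < nstep (twKer γ 0) n 0 z') :
    ∃ y, 0 < γ y ∧ dotR b (emb y) ≠ 0 := by
  by_contra! hcon
  have key : ∀ n : ℕ, ∀ z, 0 < nstep (twKer γ 0) n z z' →
      dotR b (emb z) = dotR b (emb z') := by
    intro n
    induction n with
    | zero =>
      intro z hz
      by_cases hc : z' = z
      · rw [hc]
      · simp [nstep, hc] at hz
    | succ n ih =>
      intro z hz
      obtain ⟨w, hw⟩ : ∃ w, twKer γ 0 z w * nstep (twKer γ 0) n w z' ≠ 0 := by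
        by_contra! hcon
        simp [nstep, hcon] at hz
      rw [mul_ne_zero_iff] at hw
      have hw1 : 0 < γ (w - z) := by
        have := pos_iff_ne_zero.2 hw.1
        rwa [twKer_zero, ENNReal.ofReal_pos] at this
      have hw2 := ih w (pos_iff_ne_zero.2 hw.2)
      have hw3 := dotR_emb_add b (w - z) z
      rw [sub_add_cancel, hcon _ hw1, zero_add] at hw3
      rw [← hw3, hw2]
  apply hz'
  rw [← key n 0 hn]
  simp [dotR, emb]

end Exponentials

section Quadrant

variable {γ : Z2 → ℝ} {K : Set Z2}

/-- If the twisted walk is centered in the direction `b`, then its `b`-coordinate at the exit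
from a set on which this coordinate is positive is integrable. -/
lemma exitLExp_abs_dotR_mul_exp_ne_top (hγ0 : ∀ z, 0 ≤ γ z)
    (hA3 : ∀ a : R2, Summable fun z : Z2 => γ z * Real.exp (dotR a (emb z)))
    {a b : R2} (ha : jgf γ a = 1) (hb : dotR b (gradJgf γ a) = 0)
    {y : Z2} (hy : 0 < γ y) (hby : dotR b (emb y) ≠ 0)
    (hK : ∀ z, z ∈ K → 0 < dotR b (emb z)) (z : Z2) :
    exitLExp (twKer γ 0) K z
      (fun w => |dotR b (emb w) * Real.exp (dotR a (emb w))|) ≠ ⊤ := by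
  have hM1 : 0 < jgf γ (a - b) - 1 := by
    have := jgf_lt_jgf_sub hγ0 hA3 hb hy hby
    linarith
  set M₁ := jgf γ (a - b) with hM₁
  set M₂ := jgf γ (a - (2 : ℝ) • b) with hM₂
  have hM2 : 0 ≤ M₂ := jgf_nonneg hγ0 _
  obtain ⟨c, hc, hcM⟩ : ∃ c : ℝ, 0 < c ∧ c * (M₂ - 1) ≤ M₁ - 1 := by
    have hc : 0 < (M₁ - 1) / (M₂ + 1) := by positivity
    refine ⟨(M₁ - 1) / (M₂ + 1), hc, ?_⟩
    have : (M₁ - 1) / (M₂ + 1) * (M₂ + 1) = M₁ - 1 := div_mul_cancel₀ _ (by positivity)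
    nlinarith
  set A : ℝ := 1 + 9 / (4 * c) with hA
  have habs : ∀ x : ℝ, |x| ≤ x + A - Real.exp (-x) + c * Real.exp (-x) ^ 2 := by
    intro x
    have hu := Real.exp_pos (-x)
    have hxu := Real.add_one_le_exp (-x)
    have h9 : 0 < 9 / (4 * c) := by positivity
    rcases le_total 0 x with hx | hx
    · have hu1 : Real.exp (-x) ≤ 1 := Real.exp_le_one_iff.2 (by linarith)
      rw [abs_of_nonneg hx]
      nlinarith [mul_nonneg hc.le (sq_nonneg (Real.exp (-x)))]
    · rw [abs_of_nonpos hx]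
      have h1 : 0 ≤ 9 / (4 * c) - 3 * Real.exp (-x) + c * Real.exp (-x) ^ 2 := by
        have : 9 / (4 * c) - 3 * Real.exp (-x) + c * Real.exp (-x) ^ 2 =
            (c * Real.exp (-x) - 3 / 2) ^ 2 / c := by
          field_simp
          ring
        rw [this]
        positivity
      linarith
  have h1 : ∀ w : Z2, Real.exp (dotR (a - b) (emb w)) =
      Real.exp (dotR a (emb w)) * Real.exp (-dotR b (emb w)) := by
    intro w
    rw [dotR_sub_left, sub_eq_add_neg, Real.exp_add]
  have h2 : ∀ w : Z2, Real.exp (dotR (a - (2 : ℝ) • b) (emb w)) =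
      Real.exp (dotR a (emb w)) * Real.exp (-dotR b (emb w)) ^ 2 := by
    intro w
    rw [dotR_sub_left, dotR_smul_left, ← Real.exp_nat_mul, ← Real.exp_add]
    congr 1
    push_cast
    ring
  refine ne_top_of_le_ne_top ENNReal.ofReal_ne_top (exitLExp_le_ofReal hγ0
    (G := fun w => Real.exp (dotR a (emb w)) * (dotR b (emb w) + A -
      Real.exp (-dotR b (emb w)) + c * Real.exp (-dotR b (emb w)) ^ 2))
    (fun w => ?_) (fun w _ => ?_) (fun z hz => ?_) z)
  · exact mul_nonneg (Real.exp_pos _).le ((abs_nonneg _).trans (habs _))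
  · rw [abs_mul, abs_of_pos (Real.exp_pos _), mul_comm]
    exact mul_le_mul_of_nonneg_left (habs _) (Real.exp_pos _).le
  · have hs := (((hasSum_dotR_mul_exp hγ0 hA3 a b z).add ((hasSum_exp hA3 a z).mul_left A)).sub
      (hasSum_exp hA3 (a - b) z)).add ((hasSum_exp hA3 (a - (2 : ℝ) • b) z).mul_left c)
    refine ⟨_, ?_, hs.congr_fun fun w => ?_⟩
    · rw [ha, hb, h1, h2, ← hM₁, ← hM₂]
      have hu := Real.exp_pos (-dotR b (emb z))
      have hu1 : Real.exp (-dotR b (emb z)) ≤ 1 :=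
        Real.exp_le_one_iff.2 (by linarith [hK z hz])
      set u := Real.exp (-dotR b (emb z))
      have h3 : c * u ^ 2 * (M₂ - 1) ≤ u * (M₁ - 1) := by
        have h4 : u ^ 2 * (c * (M₂ - 1)) ≤ u ^ 2 * (M₁ - 1) :=
          mul_le_mul_of_nonneg_left hcM (sq_nonneg u)
        have h5 : u ^ 2 * (M₁ - 1) ≤ u * (M₁ - 1) :=
          mul_le_mul_of_nonneg_right (by nlinarith) hM1.le
        linarith
      have h6 := mul_le_mul_of_nonneg_left h3 (Real.exp_pos (dotR a (emb z))).le
      linarith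
    · rw [h1, h2]
      ring

/-- If the twisted walk is centered in the direction `b` and drifts to infinity in the direction
`b'`, then far away in the direction `b'` its mean `b`-coordinate at the exit is small. -/
lemma exists_exitLExp_dotR_mul_exp_lt (hγ0 : ∀ z, 0 ≤ γ z)
    (hA3 : ∀ a : R2, Summable fun z : Z2 => γ z * Real.exp (dotR a (emb z)))
    {a b b' : R2} (ha : jgf γ a = 1) (hb : dotR b (gradJgf γ a) = 0)
    (hb' : 0 < dotR b' (gradJgf γ a))
    (hK : ∀ z, z ∉ K → 0 < dotR b (emb z) → dotR b' (emb z) ≤ 0)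
    (hfar : ∀ N : ℝ, ∃ z, z ∈ K ∧ dotR b (emb z) = 1 ∧ N ≤ dotR b' (emb z)) :
    ∃ z, z ∈ K ∧ exitLExp (twKer γ 0) K z (fun w => dotR b (emb w) * Real.exp (dotR a (emb w))) <
      ENNReal.ofReal (dotR b (emb z) * Real.exp (dotR a (emb z))) := by
  obtain ⟨θ, hθ, hlt⟩ := exists_jgf_sub_smul_lt_one hγ0 hA3 (b := b' - b) ha
    (by rw [dotR_sub_left, hb, sub_zero]; exact hb')
  have hG : ∀ w : Z2, Real.exp (dotR (a - θ • (b' - b)) (emb w)) =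
      Real.exp (dotR a (emb w)) * Real.exp (θ * (dotR b (emb w) - dotR b' (emb w))) := by
    intro w
    rw [dotR_sub_left, dotR_smul_left, dotR_sub_left, ← Real.exp_add]
    congr 1
    ring
  obtain ⟨z, hz, hz1, hzN⟩ := hfar (θ⁻¹ * θ⁻¹ + 1)
  refine ⟨z, hz, lt_of_le_of_lt (exitLExp_le_ofReal hγ0
    (G := fun w => θ⁻¹ * Real.exp (dotR (a - θ • (b' - b)) (emb w)))
    (fun w => by positivity) (fun w hw => ?_) (fun z hz => ?_) z) ?_⟩
  · rw [hG]
    rcases le_or_gt (dotR b (emb w)) 0 with h | h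
    · exact (mul_nonpos_of_nonpos_of_nonneg h (Real.exp_pos _).le).trans (by positivity)
    · have h1 := hK w hw h
      have h2 := Real.add_one_le_exp (θ * (dotR b (emb w) - dotR b' (emb w)))
      have h3 : θ * dotR b (emb w) ≤ Real.exp (θ * (dotR b (emb w) - dotR b' (emb w))) := by
        nlinarith
      have h4 : dotR b (emb w) ≤
          θ⁻¹ * Real.exp (θ * (dotR b (emb w) - dotR b' (emb w))) := by
        rwa [le_inv_mul_iff₀ hθ]
      have h5 := mul_le_mul_of_nonneg_right h4 (Real.exp_pos (dotR a (emb w))).le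
      linarith
  · refine ⟨_, ?_, ((hasSum_exp hA3 (a - θ • (b' - b)) z).mul_left θ⁻¹).congr_fun fun w => ?_⟩
    · gcongr
      exact mul_le_of_le_one_right (Real.exp_pos _).le hlt.le
    · ring
  · rw [hG, hz1, one_mul]
    refine (ENNReal.ofReal_lt_ofReal_iff (Real.exp_pos _)).2 ?_
    have h1 : θ⁻¹ < Real.exp (θ * (dotR b' (emb z) - 1)) := by
      have h2 := Real.add_one_le_exp (θ * (dotR b' (emb z) - 1))
      have h3 : θ⁻¹ ≤ θ * (dotR b' (emb z) - 1) := by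
        have h4 : θ * (θ⁻¹ * θ⁻¹) = θ⁻¹ := by field_simp
        nlinarith
      linarith
    have h2 : θ⁻¹ * Real.exp (θ * (1 - dotR b' (emb z))) < 1 := by
      have h3 : θ * (1 - dotR b' (emb z)) = -(θ * (dotR b' (emb z) - 1)) := by ring
      rw [h3, Real.exp_neg, ← div_eq_mul_inv]
      exact (div_lt_one (Real.exp_pos _)).2 h1
    have h3 := mul_lt_mul_of_pos_right h2 (Real.exp_pos (dotR a (emb z)))
    linarith

/-- If the twisted walk drifts to infinity in two directions, its probability to ever leave the
corresponding quadrant is small far away from the boundary. -/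
lemma exitLExp_exp_ne_top_and_exists_lt (hγ0 : ∀ z, 0 ≤ γ z)
    (hA3 : ∀ a : R2, Summable fun z : Z2 => γ z * Real.exp (dotR a (emb z)))
    {a b b' : R2} (ha : jgf γ a = 1) (hb : 0 < dotR b (gradJgf γ a))
    (hb' : 0 < dotR b' (gradJgf γ a))
    (hK : ∀ z, z ∉ K → dotR b (emb z) ≤ 0 ∨ dotR b' (emb z) ≤ 0)
    (hfar : ∀ N : ℝ, ∃ z, z ∈ K ∧ N ≤ dotR b (emb z) ∧ N ≤ dotR b' (emb z)) :
    (∀ z, exitLExp (twKer γ 0) K z (fun w => Real.exp (dotR a (emb w))) ≠ ⊤) ∧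
    ∃ z, z ∈ K ∧ exitLExp (twKer γ 0) K z (fun w => Real.exp (dotR a (emb w))) <
      ENNReal.ofReal (Real.exp (dotR a (emb z))) := by
  obtain ⟨θ, hθ, hlt⟩ := exists_jgf_sub_smul_lt_one hγ0 hA3 ha hb
  obtain ⟨θ', hθ', hlt'⟩ := exists_jgf_sub_smul_lt_one hγ0 hA3 ha hb'
  have hG : ∀ (t : ℝ) (c : R2) (w : Z2), Real.exp (dotR (a - t • c) (emb w)) =
      Real.exp (dotR a (emb w)) * Real.exp (-(t * dotR c (emb w))) := by
    intro t c w
    rw [dotR_sub_left, dotR_smul_left, sub_eq_add_neg, Real.exp_add]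
  have hle : ∀ z, exitLExp (twKer γ 0) K z (fun w => Real.exp (dotR a (emb w))) ≤
      ENNReal.ofReal (Real.exp (dotR (a - θ • b) (emb z)) +
        Real.exp (dotR (a - θ' • b') (emb z))) := by
    refine exitLExp_le_ofReal hγ0 (fun w => by positivity) (fun w hw => ?_) (fun z hz => ?_)
    · have hexit : ∀ (t : ℝ) (c : R2), 0 < t → dotR c (emb w) ≤ 0 →
          Real.exp (dotR a (emb w)) ≤ Real.exp (dotR (a - t • c) (emb w)) := by
        intro t c ht hc
        rw [Real.exp_le_exp, dotR_sub_left, dotR_smul_left]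
        nlinarith
      rcases hK w hw with h | h
      · exact (hexit θ b hθ h).trans (le_add_of_nonneg_right (Real.exp_pos _).le)
      · exact (hexit θ' b' hθ' h).trans (le_add_of_nonneg_left (Real.exp_pos _).le)
    · refine ⟨_, ?_, ((hasSum_exp hA3 (a - θ • b) z).add
        (hasSum_exp hA3 (a - θ' • b') z)).congr_fun fun w => ?_⟩
      · exact add_le_add (mul_le_of_le_one_right (Real.exp_pos _).le hlt.le)
          (mul_le_of_le_one_right (Real.exp_pos _).le hlt'.le)
      · ring
  refine ⟨fun z => ne_top_of_le_ne_top ENNReal.ofReal_ne_top (hle z), ?_⟩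
  obtain ⟨z, hz, h1, h2⟩ := hfar (max (2 / θ) (2 / θ'))
  refine ⟨z, hz, (hle z).trans_lt ?_⟩
  refine (ENNReal.ofReal_lt_ofReal_iff (Real.exp_pos _)).2 ?_
  have hhalf : ∀ (t x : ℝ), 0 < t → 2 / t ≤ x → Real.exp (-(t * x)) < 1 / 2 := by
    intro t x ht hx
    rw [div_le_iff₀ ht] at hx
    rw [Real.exp_neg, inv_lt_comm₀ (Real.exp_pos _) (by norm_num)]
    have := Real.add_one_le_exp (t * x)
    norm_num
    linarith
  have h3 := hhalf θ _ hθ ((le_max_left _ _).trans h1)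
  have h4 := hhalf θ' _ hθ' ((le_max_right _ _).trans h2)
  rw [hG, hG]
  nlinarith [Real.exp_pos (dotR a (emb z))]

/-- The centered case: harmonicity and positivity of
`(b·z)e^{a·z} − 𝔼_z[(b·S(τ))e^{a·S(τ)}; τ < ∞]`. -/
lemma harmonic_of_centered (hγ0 : ∀ z, 0 ≤ γ z)
    (hA1 : ∀ z z' : Z2, ∃ n : ℕ, 0 < nstep (twKer γ 0) n z z')
    (hA2 : ∀ z z' : Z2, z ∈ K → z' ∈ K → ∃ n : ℕ, 0 < aliveP (twKer γ 0) K n z z')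
    (hA3 : ∀ a : R2, Summable fun z : Z2 => γ z * Real.exp (dotR a (emb z)))
    {a b b' : R2} (ha : jgf γ a = 1) (hb : dotR b (gradJgf γ a) = 0)
    (hb' : 0 < dotR b' (gradJgf γ a))
    (hK : ∀ z, z ∈ K ↔ 0 < dotR b (emb z) ∧ 0 < dotR b' (emb z))
    (hfar : ∀ N : ℝ, ∃ z, dotR b (emb z) = 1 ∧ N ≤ dotR b' (emb z))
    {h : Z2 → ℝ} (hh : ∀ w, h w = dotR b (emb w) * Real.exp (dotR a (emb w)) -
      exitExp (twKer γ 0) K w (fun w => dotR b (emb w) * Real.exp (dotR a (emb w))))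
    {z : Z2} (hz : z ∈ K) :
    exitLExp (twKer γ 0) K z (fun w => |dotR b (emb w)| * Real.exp (dotR a (emb w))) ≠ ⊤ ∧
      0 < h z ∧ (∑' z' : Z2, if z' ∈ K then γ (z' - z) * h z' else 0) = h z := by
  obtain ⟨y, hy, hby⟩ : ∃ y, 0 < γ y ∧ dotR b (emb y) ≠ 0 := by
    obtain ⟨z', hz', -⟩ := hfar 0
    obtain ⟨n, hn⟩ := hA1 0 z'
    exact exists_step_dotR_ne_zero (by rw [hz']; exact one_ne_zero) hn
  have hfin := exitLExp_abs_dotR_mul_exp_ne_top hγ0 hA3 ha hb hy hby (fun z hz => ((hK z).1 hz).1)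
  obtain ⟨z₀, hz₀, hlt⟩ := exists_exitLExp_dotR_mul_exp_lt (K := K) hγ0 hA3 ha hb hb'
    (fun z hz h1 => not_lt.1 fun h2 => hz ((hK z).2 ⟨h1, h2⟩))
    (fun N => by
      obtain ⟨z, h1, h2⟩ := hfar (max N 1)
      refine ⟨z, (hK z).2 ⟨by linarith, ?_⟩, h1, (le_max_left _ _).trans h2⟩
      exact lt_of_lt_of_le one_pos ((le_max_right _ _).trans h2))
  refine ⟨?_, sub_exitExp_pos_and_harmonic hγ0 hA2 (fun z => ?_) (fun z hz => ?_) hfin hz₀ hlt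
    hh hz⟩
  · simpa only [abs_mul, abs_of_pos (Real.exp_pos _)] using hfin z
  · have := hasSum_dotR_mul_exp hγ0 hA3 a b z
    rw [ha, hb, mul_one, add_zero, mul_comm] at this
    exact this
  · exact mul_nonneg ((hK z).1 hz).1.le (Real.exp_pos _).le

lemma pos_of_qmap_nonneg {a : R2} (hg : gradJgf γ a ≠ (0, 0))
    (hq : 0 ≤ (qmap γ a).1 ∧ 0 ≤ (qmap γ a).2) (hq1 : qmap γ a ≠ ((0 : ℝ), (1 : ℝ)))
    (hq2 : qmap γ a ≠ ((1 : ℝ), (0 : ℝ))) : 0 < (gradJgf γ a).1 ∧ 0 < (gradJgf γ a).2 := by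
  unfold qmap at hq hq1 hq2
  generalize gradJgf γ a = v at *
  obtain ⟨x, y⟩ := v
  simp only [nrm, dotR, Prod.smul_mk, smul_eq_mul, ne_eq, Prod.mk.injEq] at *
  have hpos : 0 < Real.sqrt (x * x + y * y) := by
    refine Real.sqrt_pos.2 (lt_of_le_of_ne (by nlinarith) fun h0 => hg ?_)
    exact ⟨by nlinarith, by nlinarith⟩
  have hx : 0 ≤ x := nonneg_of_mul_nonneg_right hq.1 (inv_pos.2 hpos)
  have hy : 0 ≤ y := nonneg_of_mul_nonneg_right hq.2 (inv_pos.2 hpos)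
  refine ⟨lt_of_le_of_ne hx fun h0 => ?_, lt_of_le_of_ne hy fun h0 => ?_⟩
  · subst h0
    have hy0 : y ≠ 0 := fun h => hg ⟨rfl, h⟩
    refine hq1 ⟨mul_zero _, ?_⟩
    rw [mul_zero, zero_add, Real.sqrt_mul_self hy, inv_mul_cancel₀ hy0]
  · subst h0
    have hx0 : x ≠ 0 := fun h => hg ⟨h, rfl⟩
    refine hq2 ⟨?_, mul_zero _⟩
    rw [mul_zero, add_zero, Real.sqrt_mul_self hx, inv_mul_cancel₀ hx0]

end Quadrant

/-- **Proposition 2** (harmonic functions for the positive quadrant, from Ignatiouk-Robert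
and Loree).  For every `a ∈ Γ₊ = {a ∈ ∂D : q(a) ∈ ℝ₊², |q(a)| = 1}` and every
`z = (x₁,x₂) ∈ ℕ* × ℕ*`, the function
`h_a(z) = x₁e^{a·z} − 𝔼_z[S₁(τ)e^{a·S(τ)}; τ < ∞]` if `q(a) = (0,1)`,
`h_a(z) = x₂e^{a·z} − 𝔼_z[S₂(τ)e^{a·S(τ)}; τ < ∞]` if `q(a) = (1,0)`, and
`h_a(z) = e^{a·z} − 𝔼_z[e^{a·S(τ)}; τ < ∞]` otherwise, is strictly positive and harmonic
for the random walk killed when leaving the positive quadrant. -/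
theorem harmonic_functions_positive_quadrant
    (γ : Z2 → ℝ)
    -- `γ` is a probability distribution on `ℤ²`
    (hγ0 : ∀ z : Z2, 0 ≤ γ z) (hγ1 : HasSum γ 1)
    -- `K` is the open positive quadrant (on the lattice: `ℕ* × ℕ*`)
    (K : Set Z2) (hK : K = {z : Z2 | 0 < z.1 ∧ 0 < z.2})
    -- (A1) the walk is irreducible with nonzero mean
    (hA1 : ∀ z z' : Z2, ∃ n : ℕ, 0 < nstep (twKer γ 0) n z z')
    (hmean : (∑' z : Z2, γ z * (z.1 : ℝ), ∑' z : Z2, γ z * (z.2 : ℝ)) ≠ (0, 0))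
    -- (A2) the walk killed when leaving `K` is irreducible in `K`
    (hA2 : ∀ z z' : Z2, z ∈ K → z' ∈ K → ∃ n : ℕ, 0 < aliveP (twKer γ 0) K n z z')
    -- (A3) the jump generating function is finite everywhere
    (hA3 : ∀ a : R2, Summable fun z : Z2 => γ z * Real.exp (dotR a (emb z)))
    -- (A4) each coordinate walk `Sᵢ(n)` is aperiodic on `ℤ`
    (hA4₁ : ∀ d : ℕ,
        (∀ n : ℕ, 0 < n →
          0 < ∑' z : Z2, (if z.1 = 0 then nstep (twKer γ 0) n 0 z else 0) → d ∣ n) → d = 1)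
    (hA4₂ : ∀ d : ℕ,
        (∀ n : ℕ, 0 < n →
          0 < ∑' z : Z2, (if z.2 = 0 then nstep (twKer γ 0) n 0 z else 0) → d ∣ n) → d = 1)
    -- `a ∈ Γ₊`
    (a : R2) (haD : jgf γ a = 1) (haq : 0 ≤ (qmap γ a).1 ∧ 0 ≤ (qmap γ a).2) :
    -- case `q(a) = (0,1)`
    (qmap γ a = ((0 : ℝ), (1 : ℝ)) →
      ∀ h : Z2 → ℝ,
        h = (fun w => (w.1 : ℝ) * Real.exp (dotR a (emb w))
              - exitExp (twKer γ 0) K w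
                  (fun z' => (z'.1 : ℝ) * Real.exp (dotR a (emb z')))) →
        ∀ z : Z2, z ∈ K →
          exitLExp (twKer γ 0) K z
              (fun z' => |(z'.1 : ℝ)| * Real.exp (dotR a (emb z'))) ≠ ⊤ ∧
          0 < h z ∧
          (∑' z' : Z2, if z' ∈ K then γ (z' - z) * h z' else 0) = h z) ∧
    -- case `q(a) = (1,0)`
    (qmap γ a = ((1 : ℝ), (0 : ℝ)) →
      ∀ h : Z2 → ℝ,
        h = (fun w => (w.2 : ℝ) * Real.exp (dotR a (emb w))
              - exitExp (twKer γ 0) K w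
                  (fun z' => (z'.2 : ℝ) * Real.exp (dotR a (emb z')))) →
        ∀ z : Z2, z ∈ K →
          exitLExp (twKer γ 0) K z
              (fun z' => |(z'.2 : ℝ)| * Real.exp (dotR a (emb z'))) ≠ ⊤ ∧
          0 < h z ∧
          (∑' z' : Z2, if z' ∈ K then γ (z' - z) * h z' else 0) = h z) ∧
    -- remaining case
    (qmap γ a ≠ ((0 : ℝ), (1 : ℝ)) → qmap γ a ≠ ((1 : ℝ), (0 : ℝ)) →
      ∀ h : Z2 → ℝ,
        h = (fun w => Real.exp (dotR a (emb w))
              - (exitLExp (twKer γ 0) K w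
                  (fun z' => Real.exp (dotR a (emb z')))).toReal) →
        ∀ z : Z2, z ∈ K →
          exitLExp (twKer γ 0) K z (fun z' => Real.exp (dotR a (emb z'))) ≠ ⊤ ∧
          0 < h z ∧
          (∑' z' : Z2, if z' ∈ K then γ (z' - z) * h z' else 0) = h z) := by
  have e1 : ∀ v : R2, dotR (1, 0) v = v.1 := fun v => by simp [dotR]
  have e2 : ∀ v : R2, dotR (0, 1) v = v.2 := fun v => by simp [dotR]
  have hnrm : 0 ≤ nrm (gradJgf γ a) := Real.sqrt_nonneg _
  refine ⟨fun hq h hh z hz => ?_, fun hq h hh z hz => ?_, fun hq1 hq2 h hh z hz => ?_⟩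
  · have h1 : (nrm (gradJgf γ a))⁻¹ * (gradJgf γ a).1 = 0 := congrArg Prod.fst hq
    have h2 : (nrm (gradJgf γ a))⁻¹ * (gradJgf γ a).2 = 1 := congrArg Prod.snd hq
    have h3 : (nrm (gradJgf γ a))⁻¹ ≠ 0 := left_ne_zero_of_mul_eq_one h2
    have h4 := harmonic_of_centered (b := (1, 0)) (b' := (0, 1)) (K := K) (h := h) (z := z)
      hγ0 hA1 hA2 hA3 haD
      (by rw [e1]; exact (mul_eq_zero.1 h1).resolve_left h3)
      (by rw [e2]; exact pos_of_mul_pos_right (h2 ▸ one_pos) (inv_nonneg.2 hnrm))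
      (fun z => by simp [hK, e1, e2, emb])
      (fun N => by
        obtain ⟨n, hn⟩ := exists_nat_ge N
        exact ⟨(1, n), by simp [e1, emb], by simpa [e2, emb] using hn⟩)
      (fun w => by rw [hh]; simp only [e1]; rfl) hz
    simpa only [e1, emb] using h4
  · have h1 : (nrm (gradJgf γ a))⁻¹ * (gradJgf γ a).1 = 1 := congrArg Prod.fst hq
    have h2 : (nrm (gradJgf γ a))⁻¹ * (gradJgf γ a).2 = 0 := congrArg Prod.snd hq
    have h3 : (nrm (gradJgf γ a))⁻¹ ≠ 0 := left_ne_zero_of_mul_eq_one h1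
    have h4 := harmonic_of_centered (b := (0, 1)) (b' := (1, 0)) (K := K) (h := h) (z := z)
      hγ0 hA1 hA2 hA3 haD
      (by rw [e2]; exact (mul_eq_zero.1 h2).resolve_left h3)
      (by rw [e1]; exact pos_of_mul_pos_right (h1 ▸ one_pos) (inv_nonneg.2 hnrm))
      (fun z => by simp [hK, e1, e2, emb, and_comm])
      (fun N => by
        obtain ⟨n, hn⟩ := exists_nat_ge N
        exact ⟨(n, 1), by simp [e2, emb], by simpa [e1, emb] using hn⟩)
      (fun w => by rw [hh]; simp only [e2]; rfl) hz
    simpa only [e2, emb] using h4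
  · have hg := gradJgf_ne_zero hγ0 hγ1 hA3 hmean haD
    obtain ⟨hg1, hg2⟩ := pos_of_qmap_nonneg hg haq hq1 hq2
    obtain ⟨hfin, z₀, hz₀, hlt⟩ := exitLExp_exp_ne_top_and_exists_lt (b := (1, 0)) (b' := (0, 1))
      (K := K) hγ0 hA3 haD (by rwa [e1]) (by rwa [e2])
      (fun z hz => by
        by_contra! hcon
        simp only [e1, e2, emb, Int.cast_pos] at hcon
        exact hz (hK ▸ hcon))
      (fun N => by
        obtain ⟨n, hn⟩ := exists_nat_ge N
        refine ⟨(n + 1, n + 1), hK ▸ ⟨by positivity, by positivity⟩, ?_, ?_⟩ <;>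
        · simp only [e1, e2, emb]
          push_cast
          linarith)
    refine ⟨hfin z, sub_exitExp_pos_and_harmonic hγ0 hA2 (fun z => ?_)
      (fun z _ => (Real.exp_pos _).le) (fun z => ?_) hz₀ hlt (fun w => ?_) hz⟩
    · simpa only [haD, mul_one] using hasSum_exp hA3 a z
    · simpa only [abs_of_pos (Real.exp_pos _)] using hfin z
    · have h0 : exitLExp (twKer γ 0) K w (fun w => -Real.exp (dotR a (emb w))) = 0 := by
        simp [exitLExp, ENNReal.ofReal_of_nonpos (neg_nonpos.2 (Real.exp_pos _).le)]
      rw [hh, exitExp, h0, ENNReal.toReal_zero, sub_zero]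
end KilledRW
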